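/- Let f be an isoarithmetic IASI with common difference d of a finite simple graph G. In the total graph T(G), label each vertex of G by f(v) and each edge e of G by f⁺(e). Then every vertex label and every edge label of T(G) under this labeling is a d-AP-set. -/

import Mathlib

open Pointwise

/-- A finite set of naturals is a `d`-AP-set if `d > 0`, it has at least 3 elements,
and its elements form an arithmetic progression with common difference `d`. -/
def IsAPSet (d : ℕ) (A : Finset ℕ) : Prop :=
  0 < d ∧ 3 ≤ A.card ∧ ∃ a : ℕ, A = (Finset.range A.card).image (fun i => a + i * d)

/-- An integer additive set-indexer (IASI) of a simple graph `G`: an injective labeling of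
vertices by nonempty finite sets of naturals whose induced edge labeling
`f⁺(uv) = f(u) + f(v)` (sumset) is injective on edges. -/
structure IsIASI {V : Type*} (G : SimpleGraph V) (f : V → Finset ℕ) : Prop where
  injective : Function.Injective f
  nonempty : ∀ v, (f v).Nonempty
  edgeInjective : ∀ ⦃u v x y : V⦄, G.Adj u v → G.Adj x y →
    f u + f v = f x + f y → s(u, v) = s(x, y)

/-- An isoarithmetic IASI of `G` with common difference `d`: an IASI all of whose vertex
and edge labels are `d`-AP-sets. -/
def IsIsoarithmeticIASI {V : Type*} (G : SimpleGraph V) (f : V → Finset ℕ) (d : ℕ) : Prop :=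
  IsIASI G f ∧ (∀ v, IsAPSet d (f v)) ∧ (∀ u v, G.Adj u v → IsAPSet d (f u + f v))

theorem isAPSet_image_range {d n : ℕ} (hd : 0 < d) (hn : 3 ≤ n) (a : ℕ) :
    IsAPSet d ((Finset.range n).image fun i => a + i * d) := by
  have hcard : ((Finset.range n).image fun i => a + i * d).card = n := by
    rw [Finset.card_image_of_injective, Finset.card_range]
    intro i j hij
    exact Nat.eq_of_mul_eq_mul_right hd (Nat.add_left_cancel hij)
  exact ⟨hd, by rwa [hcard], a, by rw [hcard]⟩

theorem image_range_add_image_range {m n : ℕ} (hm : 0 < m) (hn : 0 < n) (a b d : ℕ) :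
    ((Finset.range m).image fun i => a + i * d) + ((Finset.range n).image fun i => b + i * d) =
      (Finset.range (m + n - 1)).image fun i => a + b + i * d := by
  ext x
  simp only [Finset.mem_add, Finset.mem_image, Finset.mem_range]
  constructor
  · rintro ⟨_, ⟨i, hi, rfl⟩, _, ⟨j, hj, rfl⟩, rfl⟩
    exact ⟨i + j, by omega, by ring⟩
  · rintro ⟨k, hk, rfl⟩
    obtain ⟨i, j, hi, hj, rfl⟩ : ∃ i j, i < m ∧ j < n ∧ k = i + j :=
      ⟨min k (m - 1), k - min k (m - 1), by omega, by omega, by omega⟩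
    exact ⟨_, ⟨i, hi, rfl⟩, _, ⟨j, hj, rfl⟩, by ring⟩

theorem IsAPSet.add {d : ℕ} {A B : Finset ℕ} (hA : IsAPSet d A) (hB : IsAPSet d B) :
    IsAPSet d (A + B) := by
  obtain ⟨hd, hm, a, ha⟩ := hA
  obtain ⟨-, hn, b, hb⟩ := hB
  rw [ha, hb, image_range_add_image_range (by omega) (by omega)]
  exact isAPSet_image_range hd (by omega) _

/-- In the total graph `T(G)` of an isoarithmetic IASI graph `G`, labeling each vertex of
`G` by `f(v)` and each edge `e` of `G` by `f⁺(e)`, every vertex label and every edge label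
of `T(G)` is a `d`-AP-set (edges of `T(G)`: adjacent vertices of `G`, distinct edges of
`G` sharing an endpoint, and incident vertex-edge pairs of `G`). -/
theorem stmt8 {V : Type*} [Fintype V] (G : SimpleGraph V)
    (f : V → Finset ℕ) (d : ℕ) (h : IsIsoarithmeticIASI G f d) :
    (∀ v, IsAPSet d (f v)) ∧
    (∀ x y, G.Adj x y → IsAPSet d (f x + f y)) ∧
    (∀ u v, G.Adj u v → IsAPSet d (f u + f v)) ∧
    (∀ a b c, G.Adj a b → G.Adj b c → s(a, b) ≠ s(b, c) →
      IsAPSet d ((f a + f b) + (f b + f c))) ∧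
    (∀ v x y, G.Adj x y → (v = x ∨ v = y) → IsAPSet d (f v + (f x + f y))) := by
  obtain ⟨-, hv, he⟩ := h
  exact ⟨hv, he, he, fun a b c hab hbc _ => (he a b hab).add (he b c hbc),
    fun v x y hxy _ => (hv v).add (he x y hxy)⟩
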